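/- (Kostuchenko–Stepanov) Let (γ_k)_{k≥1} be a strictly increasing sequence of real numbers tending to +∞, and let (χ_k)_{k≥1} be a sequence of real numbers with χ_k < γ_k < χ_{k+1} for all k. Then the following are equivalent: (i) there exist a real number C > 0 and positive weights (ν_k)_{k≥1} with Σ_k ν_k < ∞ such that the set {χ_k : k ≥ 1} is exactly the set of real solutions of Σ_k ν_k/(γ_k − λ) = C; (ii) Σ_{k=1}^{∞} (γ_k − χ_k) < ∞. Moreover, in case (i) the identity C · Σ_{k=1}^{∞} (γ_k − χ_k) = Σ_{k=1}^{∞} ν_k holds. -/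

import Mathlib

open Filter Topology Finset

/-- Partial fraction expansion of `∏ (1 + dⱼ / (x - bⱼ))`; the residues sum to `∑ dⱼ`.
The factor with `j = i` in the residue at `bᵢ` is `1` because `dᵢ / 0 = 0`. -/
theorem prod_one_add_div_sub_partial_fractions {ι : Type*} [DecidableEq ι] (b d : ι → ℝ)
    (hb : Function.Injective b) (s : Finset ι) :
    (∑ i ∈ s, d i * ∏ j ∈ s, (1 + d j / (b i - b j)) = ∑ i ∈ s, d i) ∧
    ∀ x, (∀ i ∈ s, x ≠ b i) → ∏ j ∈ s, (1 + d j / (x - b j)) =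
      1 + ∑ i ∈ s, d i * (∏ j ∈ s, (1 + d j / (b i - b j))) / (x - b i) := by
  induction s using Finset.induction_on with
  | empty => simp
  | insert m s hm ih =>
    obtain ⟨ih_sum, ih_prod⟩ := ih
    have hne : ∀ i ∈ s, b i - b m ≠ 0 := fun i hi h =>
      hm (hb (sub_eq_zero.mp h) ▸ hi)
    have hbm : ∀ i ∈ s, b m ≠ b i := fun i hi h => hm (hb h ▸ hi)
    simp only [prod_insert hm, sum_insert hm, sub_self, div_zero, add_zero, one_mul]
    rw [ih_prod _ hbm]
    refine ⟨?_, fun x hx => ?_⟩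
    · rw [← ih_sum, mul_add, mul_sum, mul_one, add_assoc, ← sum_add_distrib]
      congr 1
      refine sum_congr rfl fun i hi => ?_
      have h1 := hne i hi
      have h2 : b m - b i ≠ 0 := sub_ne_zero.mpr (hbm i hi)
      rw [show b m - b i = -(b i - b m) by ring]
      generalize ∏ j ∈ s, (1 + d j / (b i - b j)) = p
      field_simp
      ring
    · have hxm : x - b m ≠ 0 := sub_ne_zero.mpr (hx m (mem_insert_self m s))
      rw [ih_prod x fun i hi => hx i (mem_insert_of_mem hi), mul_add, mul_add, mul_sum, mul_sum,
        add_div, sum_div, mul_one, mul_one, add_assoc, add_assoc, ← sum_add_distrib]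
      congr 2
      refine sum_congr rfl fun i hi => ?_
      have h1 := hne i hi
      have h3 : x - b i ≠ 0 := sub_ne_zero.mpr (hx i (mem_insert_of_mem hi))
      rw [show b m - b i = -(b i - b m) by ring]
      generalize ∏ j ∈ s, (1 + d j / (b i - b j)) = p
      field_simp
      ring

/-- If the nonnegative rows `u n` have partial sums `∑_{k<n} u n k` bounded by `S` and converge
entrywise to `L`, then `L` is summable and the rows converge to `L` against null sequences. -/
theorem summable_and_tendsto_sum_mul_of_tendsto_zero {u : ℕ → ℕ → ℝ} {L : ℕ → ℝ} {S : ℝ}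
    (hu : ∀ n k, 0 ≤ u n k) (hS : ∀ n, ∑ k ∈ range n, u n k ≤ S)
    (hL : ∀ k, Tendsto (fun n => u n k) atTop (𝓝 (L k))) :
    Summable L ∧ ∀ h : ℕ → ℝ, Tendsto h atTop (𝓝 0) →
      Tendsto (fun n => ∑ k ∈ range n, u n k * h k) atTop (𝓝 (∑' k, L k * h k)) := by
  have hL0 : ∀ k, 0 ≤ L k := fun k => ge_of_tendsto' (hL k) fun n => hu n k
  have hLS : ∀ N, ∑ k ∈ range N, L k ≤ S := fun N => by
    refine le_of_tendsto (tendsto_finsetSum (range N) fun k _ => hL k) ?_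
    filter_upwards [eventually_ge_atTop N] with n hn
    exact (sum_le_sum_of_subset_of_nonneg (range_mono hn) fun k _ _ => hu n k).trans (hS n)
  have hLsum : Summable L := summable_of_sum_range_le hL0 hLS
  refine ⟨hLsum, fun h hh => ?_⟩
  have hS0 : 0 ≤ S := by simpa using hS 0
  have hLh : Summable fun k => L k * h k := by
    refine Summable.of_norm_bounded_eventually_nat hLsum ?_
    have := (tendsto_norm_zero.comp hh).eventually_le_const (zero_lt_one)
    filter_upwards [this] with k hk
    rw [norm_mul, Real.norm_of_nonneg (hL0 k)]
    exact mul_le_of_le_one_right (hL0 k) hk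
  have key : Tendsto (fun n => ∑ k ∈ range n, (u n k - L k) * h k) atTop (𝓝 0) := by
    rw [Metric.tendsto_atTop']
    intro ε hε
    set δ : ℝ := ε / (4 * (S + 1)) with hδ
    have hδ0 : 0 < δ := by positivity
    obtain ⟨N, hN⟩ := eventually_atTop.mp
      ((tendsto_norm_zero.comp hh).eventually_le_const hδ0)
    have hfin : Tendsto (fun n => ∑ k ∈ range N, |(u n k - L k) * h k|) atTop (𝓝 0) := by
      have : Tendsto (fun n => ∑ k ∈ range N, |(u n k - L k) * h k|) atTop
          (𝓝 (∑ k ∈ range N, |(L k - L k) * h k|)) :=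
        tendsto_finsetSum _ fun k _ => (((hL k).sub_const _).mul_const _).abs
      simpa using this
    obtain ⟨M, hM⟩ := eventually_atTop.mp (hfin.eventually_lt_const (half_pos hε))
    refine ⟨max N M, fun n hn => ?_⟩
    have hNn : N ≤ n := (le_max_left _ _).trans hn.le
    rw [dist_zero_right, Real.norm_eq_abs]
    have htail : ∑ k ∈ Ico N n, |(u n k - L k) * h k| ≤ ε / 2 := by
      calc ∑ k ∈ Ico N n, |(u n k - L k) * h k|
          ≤ ∑ k ∈ Ico N n, (u n k + L k) * δ := by
            refine sum_le_sum fun k hk => ?_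
            rw [abs_mul]
            refine mul_le_mul ?_ (hN k (mem_Ico.mp hk).1) (abs_nonneg _)
              (add_nonneg (hu n k) (hL0 k))
            exact abs_le.mpr ⟨by linarith [hu n k, hL0 k], by linarith [hu n k, hL0 k]⟩
        _ ≤ ∑ k ∈ range n, (u n k + L k) * δ := by
            refine sum_le_sum_of_subset_of_nonneg (fun k hk => ?_) fun k _ _ =>
              mul_nonneg (add_nonneg (hu n k) (hL0 k)) hδ0.le
            exact mem_range.mpr (mem_Ico.mp hk).2
        _ = (∑ k ∈ range n, u n k + ∑ k ∈ range n, L k) * δ := by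
            rw [← sum_mul, sum_add_distrib]
        _ ≤ (2 * (S + 1)) * δ := by
            refine mul_le_mul_of_nonneg_right ?_ hδ0.le
            linarith [hS n, hLS n]
        _ = ε / 2 := by
            rw [hδ]
            field_simp
            ring
    calc |∑ k ∈ range n, (u n k - L k) * h k|
        ≤ ∑ k ∈ range n, |(u n k - L k) * h k| := abs_sum_le_sum_abs _ _
      _ = ∑ k ∈ range N, |(u n k - L k) * h k| + ∑ k ∈ Ico N n, |(u n k - L k) * h k| :=
          (sum_range_add_sum_Ico _ hNn).symm
      _ < ε := by linarith [hM n ((le_max_right _ _).trans hn.le)]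
  have := key.add hLh.hasSum.tendsto_sum_nat
  rw [zero_add] at this
  refine this.congr fun n => ?_
  rw [← sum_add_distrib]
  exact sum_congr rfl fun k _ => by ring

/-- The partial products converge, and the limit vanishes exactly when some factor does. -/
theorem tendsto_prod_range_one_add_div_sub {γ d : ℕ → ℝ} (hγtop : Tendsto γ atTop atTop)
    (hd : Summable d) (hd0 : ∀ k, 0 ≤ d k) (x : ℝ) :
    ∃ P, Tendsto (fun n => ∏ j ∈ range n, (1 + d j / (x - γ j))) atTop (𝓝 P) ∧
      (P = 0 ↔ ∃ j, 1 + d j / (x - γ j) = 0) := by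
  have hs : Summable fun j => ‖d j / (x - γ j)‖ := by
    refine Summable.of_norm_bounded_eventually_nat hd ?_
    filter_upwards [hγtop.eventually_ge_atTop (x + 1)] with j hj
    rw [norm_norm, norm_div, Real.norm_of_nonneg (hd0 j)]
    refine div_le_self (hd0 j) ?_
    rw [Real.norm_eq_abs, abs_sub_comm]
    exact le_trans (by linarith) (le_abs_self _)
  have ht := (multipliable_one_add_of_summable hs).tendsto_prod_tprod_nat
  refine ⟨_, ht, fun h => ?_, fun ⟨j, hj⟩ => ?_⟩
  · by_contra! hne
    exact tprod_one_add_ne_zero_of_summable hne hs h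
  · exact tprod_of_exists_eq_zero ⟨j, hj⟩

section Interlacing

variable {γ χ : ℕ → ℝ}

theorem lt_of_interlacing (hγ : StrictMono γ) (hint : ∀ k, χ k < γ k ∧ γ k < χ (k + 1))
    {j k : ℕ} (hjk : j < k) : γ j < χ k := by
  obtain ⟨m, rfl⟩ : ∃ m, k = m + 1 := ⟨k - 1, by omega⟩
  exact (hγ.monotone (by omega)).trans_lt (hint m).2

theorem strictMono_of_interlacing (hint : ∀ k, χ k < γ k ∧ γ k < χ (k + 1)) : StrictMono χ :=
  strictMono_nat_of_lt_succ fun k => (hint k).1.trans (hint k).2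

theorem notMem_range_of_interlacing (hγ : StrictMono γ)
    (hint : ∀ k, χ k < γ k ∧ γ k < χ (k + 1)) (i : ℕ) : χ i ∉ Set.range γ := by
  rintro ⟨j, hj⟩
  rcases lt_or_ge j i with h | h
  · exact (lt_of_interlacing hγ hint h).ne hj
  · exact ((hint i).1.trans_le (hγ.monotone h)).ne' hj

theorem hasSum_gap_of_tsum_div_eq (hγ : StrictMono γ)
    (hint : ∀ k, χ k < γ k ∧ γ k < χ (k + 1)) {C : ℝ} (hC : 0 < C) {ν : ℕ → ℝ}
    (hν : ∀ k, 0 < ν k) (hνs : Summable ν) (hχ : ∀ i, ∑' k, ν k / (γ k - χ i) = C) :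
    HasSum (fun k => C * (γ k - χ k)) (∑' k, ν k) := by
  have hsum : ∀ i, Summable fun k => ν k / (γ k - χ i) := fun i => by
    by_contra h
    exact hC.ne' ((hχ i).symm.trans (tsum_eq_zero_of_not_summable h))
  have hne : ∀ k i, γ k ≠ χ i := fun k i h => notMem_range_of_interlacing hγ hint i ⟨k, h⟩
  set R : ℕ → ℕ → ℝ := fun n k => ∏ j ∈ range n, (1 + (χ j - γ j) / (γ k - χ j)) with hR
  have hfac : ∀ k j, 1 + (χ j - γ j) / (γ k - χ j) = (γ k - γ j) / (γ k - χ j) := fun k j => by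
    have := sub_ne_zero.mpr (hne k j)
    field_simp
    ring
  have hR0 : ∀ n k, k < n → R n k = 0 := fun n k hk =>
    prod_eq_zero (mem_range.mpr hk) (by rw [hfac]; simp)
  have hR01 : ∀ n k, 0 ≤ R n k ∧ R n k ≤ 1 := fun n k => by
    rcases lt_or_ge k n with h | h
    · simp [hR0 n k h]
    · have hj : ∀ j ∈ range n, 0 ≤ γ k - γ j ∧ γ k - γ j ≤ γ k - χ j := fun j hj => by
        have hjk : γ j < γ k := hγ ((mem_range.mp hj).trans_le h)
        constructor <;> linarith [(hint j).1]
      refine ⟨prod_nonneg fun j hjn => ?_, prod_le_one (fun j hjn => ?_) fun j hjn => ?_⟩ <;>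
        rw [hfac]
      · exact div_nonneg (hj j hjn).1 ((hj j hjn).1.trans (hj j hjn).2)
      · exact div_nonneg (hj j hjn).1 ((hj j hjn).1.trans (hj j hjn).2)
      · exact div_le_one_of_le₀ (hj j hjn).2 ((hj j hjn).1.trans (hj j hjn).2)
  have hident : ∀ n, HasSum (fun k => ν k * (1 - R n k)) (∑ i ∈ range n, C * (γ i - χ i)) := by
    intro n
    obtain ⟨h1, h2⟩ := prod_one_add_div_sub_partial_fractions χ (fun j => χ j - γ j)
      (strictMono_of_interlacing hint).injective (range n)
    have h3 := hasSum_sum (s := range n) fun i _ => ((hχ i ▸ (hsum i).hasSum).mul_left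
      (-((χ i - γ i) * ∏ j ∈ range n, (1 + (χ j - γ j) / (χ i - χ j)))))
    have hterm : ∀ k, ν k * (1 - R n k) = ∑ i ∈ range n, -((χ i - γ i) *
        ∏ j ∈ range n, (1 + (χ j - γ j) / (χ i - χ j))) * (ν k / (γ k - χ i)) := fun k => by
      rw [hR]
      simp only
      rw [h2 (γ k) fun i _ => hne k i, sub_add_cancel_left, ← sum_neg_distrib, mul_sum]
      exact sum_congr rfl fun i _ => by ring
    have hlimit : ∑ i ∈ range n, C * (γ i - χ i) = ∑ i ∈ range n, -((χ i - γ i) *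
        ∏ j ∈ range n, (1 + (χ j - γ j) / (χ i - χ j))) * C := by
      rw [← sum_mul, sum_neg_distrib, h1, ← mul_sum, ← sum_neg_distrib, mul_comm]
      simp
    rw [funext hterm, hlimit]
    exact h3
  rw [hasSum_iff_tendsto_nat_of_nonneg
    fun k => mul_nonneg hC.le (sub_nonneg.mpr (hint k).1.le)]
  refine tendsto_of_tendsto_of_tendsto_of_le_of_le hνs.hasSum.tendsto_sum_nat
    tendsto_const_nhds (fun n => ?_) fun n => ?_
  · calc ∑ k ∈ range n, ν k = ∑ k ∈ range n, ν k * (1 - R n k) :=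
          sum_congr rfl fun k hk => by simp [hR0 n k (mem_range.mp hk)]
      _ ≤ _ := sum_le_hasSum _ (fun k _ => mul_nonneg (hν k).le
          (sub_nonneg.mpr (hR01 n k).2)) (hident n)
  · exact hasSum_le (fun k => mul_le_of_le_one_right (hν k).le
      (by linarith [(hR01 n k).1])) (hident n) hνs.hasSum

theorem exists_weights_of_summable_gap (hγ : StrictMono γ) (hγtop : Tendsto γ atTop atTop)
    (hint : ∀ k, χ k < γ k ∧ γ k < χ (k + 1)) (hs : Summable fun k => γ k - χ k) :
    ∃ ν : ℕ → ℝ, (∀ k, 0 < ν k) ∧ Summable ν ∧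
      Set.range χ = {x : ℝ | x ∉ Set.range γ ∧ ∑' k, ν k / (γ k - x) = 1} := by
  have hd0 : ∀ k, 0 < γ k - χ k := fun k => sub_pos.mpr (hint k).1
  have hfac : ∀ k j, 0 < 1 + (γ j - χ j) / (γ k - γ j) := fun k j => by
    rcases lt_trichotomy j k with h | rfl | h
    · have := sub_pos.mpr (hγ h)
      have := hd0 j
      positivity
    · simp
    · have h1 := sub_neg.mpr (hγ h)
      have h2 := sub_neg.mpr (lt_of_interlacing hγ hint h)
      rw [show 1 + (γ j - χ j) / (γ k - γ j) = (γ k - χ j) / (γ k - γ j) by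
        have := h1.ne
        field_simp
        ring]
      exact div_pos_of_neg_of_neg h2 h1
  choose P hP hPz using tendsto_prod_range_one_add_div_sub hγtop hs fun k => (hd0 k).le
  have hPpos : ∀ k, 0 < P (γ k) := fun k =>
    lt_of_le_of_ne (ge_of_tendsto' (hP (γ k)) fun n => prod_nonneg fun j _ => (hfac k j).le)
      fun h => by
        obtain ⟨j, hj⟩ := (hPz (γ k)).mp h.symm
        exact (hfac k j).ne' hj
  set u : ℕ → ℕ → ℝ := fun n k =>
    (γ k - χ k) * ∏ j ∈ range n, (1 + (γ j - χ j) / (γ k - γ j))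
  have hpf := fun n => prod_one_add_div_sub_partial_fractions γ (fun j => γ j - χ j)
    hγ.injective (range n)
  obtain ⟨hνs, hlim⟩ := summable_and_tendsto_sum_mul_of_tendsto_zero (u := u)
    (L := fun k => (γ k - χ k) * P (γ k)) (S := ∑' k, (γ k - χ k))
    (fun n k => mul_nonneg (hd0 k).le (prod_nonneg fun j _ => (hfac k j).le))
    (fun n => (hpf n).1.trans_le (hs.sum_le_tsum _ fun k _ => (hd0 k).le))
    (fun k => (hP (γ k)).const_mul _)
  refine ⟨fun k => (γ k - χ k) * P (γ k), fun k => mul_pos (hd0 k) (hPpos k), hνs, ?_⟩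
  have hval : ∀ x, x ∉ Set.range γ →
      ∑' k, (γ k - χ k) * P (γ k) / (γ k - x) = 1 - P x := fun x hx => by
    have h0 : Tendsto (fun k => (γ k - x)⁻¹) atTop (𝓝 0) :=
      (tendsto_atTop_add_const_right _ (-x) hγtop).inv_tendsto_atTop
    have h1 := hlim _ h0
    simp only [← div_eq_mul_inv] at h1
    refine tendsto_nhds_unique h1 (((hP x).const_sub 1).congr fun n => ?_)
    rw [(hpf n).2 x fun i _ h => hx ⟨i, h.symm⟩, sub_add_cancel_left, ← sum_neg_distrib]
    refine sum_congr rfl fun k _ => ?_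
    rw [← neg_sub x (γ k), div_neg]
  ext x
  constructor
  · rintro ⟨i, rfl⟩
    have hx := notMem_range_of_interlacing hγ hint i
    refine ⟨hx, ?_⟩
    rw [hval _ hx, (hPz _).mpr ⟨i, ?_⟩, sub_zero]
    rw [← neg_sub (γ i), div_neg, div_self (hd0 i).ne', add_neg_cancel]
  · rintro ⟨hx, h⟩
    rw [hval x hx, sub_eq_self, hPz] at h
    obtain ⟨j, hj⟩ := h
    have : x - γ j ≠ 0 := fun h => hx ⟨j, (sub_eq_zero.mp h).symm⟩
    field_simp at hj
    exact ⟨j, by linarith⟩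

end Interlacing

/-- Kostuchenko–Stepanov theorem: for poles `γ_k ↑ ∞` and points `χ` interlacing from
below (`χ_k < γ_k < χ_{k+1}`), the `χ` arise as the full solution set of
`∑' ν_k/(γ_k - λ) = C` for some `C > 0` and summable positive weights `ν`
iff `∑ (γ_k - χ_k) < ∞`; and in that case `C · ∑' (γ_k - χ_k) = ∑' ν_k`. -/
theorem stmt_5 (γ χ : ℕ → ℝ) (hγ : StrictMono γ)
    (hγtop : Filter.Tendsto γ Filter.atTop Filter.atTop)
    (hint : ∀ k, χ k < γ k ∧ γ k < χ (k + 1)) :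
    ((∃ C : ℝ, 0 < C ∧ ∃ ν : ℕ → ℝ, (∀ k, 0 < ν k) ∧ Summable ν ∧
        Set.range χ
          = {lam : ℝ | lam ∉ Set.range γ ∧ (∑' k, ν k / (γ k - lam)) = C})
      ↔ Summable (fun k => γ k - χ k)) ∧
    (∀ C : ℝ, 0 < C → ∀ ν : ℕ → ℝ, (∀ k, 0 < ν k) → Summable ν →
      Set.range χ
          = {lam : ℝ | lam ∉ Set.range γ ∧ (∑' k, ν k / (γ k - lam)) = C} →
      C * ∑' k, (γ k - χ k) = ∑' k, ν k) := by
  have hgap : ∀ C : ℝ, 0 < C → ∀ ν : ℕ → ℝ, (∀ k, 0 < ν k) → Summable ν →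
      Set.range χ = {lam : ℝ | lam ∉ Set.range γ ∧ (∑' k, ν k / (γ k - lam)) = C} →
      HasSum (fun k => C * (γ k - χ k)) (∑' k, ν k) := fun C hC ν hν hνs h =>
    hasSum_gap_of_tsum_div_eq hγ hint hC hν hνs fun i =>
      (h.subset (Set.mem_range_self i)).2
  refine ⟨⟨?_, fun hs => ⟨1, one_pos, exists_weights_of_summable_gap hγ hγtop hint hs⟩⟩, ?_⟩
  · rintro ⟨C, hC, ν, hν, hνs, h⟩
    exact (summable_mul_left_iff hC.ne').mp (hgap C hC ν hν hνs h).summable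
  · intro C hC ν hν hνs h
    rw [← tsum_mul_left]
    exact (hgap C hC ν hν hνs h).tsum_eq
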